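/- Let S be a weakly cancellative Cu-semigroup satisfying (O5), the interval axiom, and the Riesz Interpolation Property, let x ∈ S and let k ≥ 2. Then x is weakly (k,ω)-divisible if and only if x is (k,ω)-divisible. -/

import Mathlib

variable {S : Type*} [AddCommMonoid S] [PartialOrder S]

/-- The (sequential) way-below relation: `x ≪ y` if for every increasing sequence whose
supremum dominates `y`, some member of the sequence dominates `x`. -/
def WayBelow (x y : S) : Prop :=
  ∀ f : ℕ → S, Monotone f → ∀ s : S, IsLUB (Set.range f) s → y ≤ s → ∃ n, x ≤ f n

/-- A Cu-semigroup (abstract Cuntz semigroup): a positively ordered commutative monoid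
satisfying the axioms (O1)-(O4). -/
structure IsCuSemigroup (S : Type*) [AddCommMonoid S] [PartialOrder S] : Prop where
  zero_le : ∀ x : S, 0 ≤ x
  add_le_add : ∀ {a b c d : S}, a ≤ b → c ≤ d → a + c ≤ b + d
  O1 : ∀ f : ℕ → S, Monotone f → ∃ s : S, IsLUB (Set.range f) s
  O2 : ∀ x : S, ∃ f : ℕ → S, (∀ n, WayBelow (f n) (f (n + 1))) ∧ IsLUB (Set.range f) x
  O3 : ∀ {x' x y' y : S}, WayBelow x' x → WayBelow y' y → WayBelow (x' + y') (x + y)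
  O4 : ∀ f g : ℕ → S, Monotone f → Monotone g → ∀ s t : S, IsLUB (Set.range f) s →
    IsLUB (Set.range g) t → IsLUB (Set.range fun n => f n + g n) (s + t)

/-- Axiom (O5) for Cu-semigroups. -/
def AxiomO5 (S : Type*) [AddCommMonoid S] [PartialOrder S] : Prop :=
  ∀ x' x y' y z : S, x + y ≤ z → WayBelow x' x → WayBelow y' y →
    ∃ c : S, x' + c ≤ z ∧ z ≤ x + c ∧ WayBelow y' c

/-- Axiom (O6) for Cu-semigroups. -/
def AxiomO6 (S : Type*) [AddCommMonoid S] [PartialOrder S] : Prop :=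
  ∀ x' x y z : S, WayBelow x' x → x ≤ y + z →
    ∃ e f : S, x' ≤ e + f ∧ e ≤ x ∧ e ≤ y ∧ f ≤ x ∧ f ≤ z

/-- Axiom (O8) for Cu-semigroups. -/
def AxiomO8 (S : Type*) [AddCommMonoid S] [PartialOrder S] : Prop :=
  ∀ x' x y' y z w : S, 2 • w = w → WayBelow (x + y) (z + w) → WayBelow x' x → WayBelow y' y →
    ∃ z₁ z₂ : S, WayBelow (z₁ + z₂) z ∧ WayBelow x' (z₁ + w) ∧ WayBelow y' (z₂ + w) ∧
      WayBelow z₁ (x + w) ∧ WayBelow z₂ (y + w)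

/-- A Cu-semigroup is weakly cancellative if `x + z ≪ y + z` implies `x ≪ y`. -/
def WeaklyCancellative (S : Type*) [AddCommMonoid S] [PartialOrder S] : Prop :=
  ∀ x y z : S, WayBelow (x + z) (y + z) → WayBelow x y

/-- An element `x` is weakly `(k,ω)`-divisible. -/
def IsWeaklyDivisible (k : ℕ) (x : S) : Prop :=
  ∀ x' : S, WayBelow x' x → ∃ (n : ℕ) (y : Fin n → S),
    (∀ j, k • y j ≤ x) ∧ x' ≤ ∑ j, y j

/-- An element `x` is `(k,ω)`-divisible. -/
def IsDivisible (k : ℕ) (x : S) : Prop :=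
  ∀ x' : S, WayBelow x' x → ∃ (n : ℕ) (y : S), k • y ≤ x ∧ x' ≤ n • y

/-- The interval axiom for Cu-semigroups. -/
def IntervalAxiom (S : Type*) [AddCommMonoid S] [PartialOrder S] : Prop :=
  ∀ x' x y u v : S, WayBelow x' x → WayBelow x (y + u) → WayBelow x (y + v) →
    ∃ w : S, WayBelow x' (y + w) ∧ WayBelow w u ∧ WayBelow w v

/-- The Riesz Interpolation Property. -/
def RieszInterpolation (S : Type*) [AddCommMonoid S] [PartialOrder S] : Prop :=
  ∀ x₁ x₂ y₁ y₂ : S, x₁ ≤ y₁ → x₁ ≤ y₂ → x₂ ≤ y₁ → x₂ ≤ y₂ →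
    ∃ z : S, x₁ ≤ z ∧ x₂ ≤ z ∧ z ≤ y₁ ∧ z ≤ y₂

/-- A Cu-semigroup is countably based if there is a countable subset such that every
element is the supremum of an increasing sequence from that subset. -/
def CountablyBased (S : Type*) [AddCommMonoid S] [PartialOrder S] : Prop :=
  ∃ B : Set S, B.Countable ∧ ∀ x : S, ∃ f : ℕ → S,
    Monotone f ∧ (∀ n, f n ∈ B) ∧ IsLUB (Set.range f) x

/-- A Cu-semigroup is inf-semilattice ordered if finite infima exist and addition
distributes over them. -/
def InfSemilatticeOrdered (S : Type*) [AddCommMonoid S] [PartialOrder S] : Prop :=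
  (∀ x y : S, ∃ m : S, IsGLB {x, y} m) ∧
    ∀ x y z m : S, IsGLB {x, y} m → IsGLB {x + z, y + z} (m + z)

namespace IsCuSemigroup

theorem isOrderedAddMonoid (hS : IsCuSemigroup S) : IsOrderedAddMonoid S where
  add_le_add_left _ _ h _ := hS.add_le_add h le_rfl

end IsCuSemigroup

namespace WayBelow

theorem le {P : Type*} [PartialOrder P] {x y : P} (h : WayBelow x y) : x ≤ y := by
  obtain ⟨n, hn⟩ := h (fun _ => y) monotone_const y (by simp) le_rfl
  exact hn

theorem trans_le {P : Type*} [PartialOrder P] {x y z : P}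
    (h : WayBelow x y) (hyz : y ≤ z) : WayBelow x z :=
  fun f hf s hs hzs => h f hf s hs (hyz.trans hzs)

end WayBelow

theorem LE.le.trans_wayBelow {P : Type*} [PartialOrder P] {x y z : P}
    (hxy : x ≤ y) (h : WayBelow y z) : WayBelow x z :=
  fun f hf s hs hzs => (h f hf s hs hzs).imp fun _ hn => hxy.trans hn

namespace IsCuSemigroup

theorem zero_wayBelow (hS : IsCuSemigroup S) (x : S) : WayBelow 0 x :=
  fun _ _ _ _ _ => ⟨0, hS.zero_le _⟩

theorem exists_monotone (hS : IsCuSemigroup S) (x : S) :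
    ∃ f : ℕ → S, Monotone f ∧ (∀ n, WayBelow (f n) x) ∧ IsLUB (Set.range f) x := by
  obtain ⟨f, hf, hx⟩ := hS.O2 x
  exact ⟨f, monotone_nat_of_le_succ fun n => (hf n).le,
    fun n => (hf n).trans_le (hx.1 ⟨n + 1, rfl⟩), hx⟩

theorem exists_between (hS : IsCuSemigroup S) {x y : S} (h : WayBelow x y) :
    ∃ z, WayBelow x z ∧ WayBelow z y := by
  obtain ⟨f, hf, hy⟩ := hS.O2 y
  obtain ⟨n, hn⟩ := h f (monotone_nat_of_le_succ fun n => (hf n).le) y hy le_rfl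
  exact ⟨f (n + 1), hn.trans_wayBelow (hf n), (hf (n + 1)).trans_le (hy.1 ⟨n + 2, rfl⟩)⟩

theorem exists_upper (hS : IsCuSemigroup S) {x y z : S} (hx : WayBelow x z)
    (hy : WayBelow y z) : ∃ w, x ≤ w ∧ y ≤ w ∧ WayBelow w z := by
  obtain ⟨f, hf, hfz, hz⟩ := hS.exists_monotone z
  obtain ⟨m, hm⟩ := hx f hf z hz le_rfl
  obtain ⟨n, hn⟩ := hy f hf z hz le_rfl
  exact ⟨f (max m n), hm.trans (hf (le_max_left _ _)), hn.trans (hf (le_max_right _ _)), hfz _⟩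

theorem exists_le_add (hS : IsCuSemigroup S) {x y z : S} (h : WayBelow x (y + z)) :
    ∃ y' z', WayBelow y' y ∧ WayBelow z' z ∧ x ≤ y' + z' := by
  obtain ⟨f, hf, hfy, hy⟩ := hS.exists_monotone y
  obtain ⟨g, hg, hgz, hz⟩ := hS.exists_monotone z
  obtain ⟨n, hn⟩ := h (fun n => f n + g n) (fun a b hab => hS.add_le_add (hf hab) (hg hab)) _
    (hS.O4 f g hf hg y z hy hz) le_rfl
  exact ⟨f n, g n, hfy n, hgz n, hn⟩

theorem nsmul_wayBelow (hS : IsCuSemigroup S) {x y : S} (h : WayBelow x y) (n : ℕ) :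
    WayBelow (n • x) (n • y) := by
  induction n with
  | zero => simpa using hS.zero_wayBelow 0
  | succ n ih => simpa [succ_nsmul] using hS.O3 ih h

theorem exists_le_nsmul (hS : IsCuSemigroup S) {y : S} (n : ℕ) {x : S}
    (h : WayBelow x (n • y)) : ∃ y', WayBelow y' y ∧ x ≤ n • y' := by
  have := hS.isOrderedAddMonoid
  induction n generalizing x with
  | zero => exact ⟨0, hS.zero_wayBelow y, by simpa using h.le⟩
  | succ n ih =>
    rw [succ_nsmul] at h
    obtain ⟨z, t, hz, ht, hx⟩ := hS.exists_le_add h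
    obtain ⟨y₁, hy₁, hzy⟩ := ih hz
    obtain ⟨w, h₁, h₂, hw⟩ := hS.exists_upper hy₁ ht
    refine ⟨w, hw, hx.trans ?_⟩
    rw [succ_nsmul]
    exact hS.add_le_add (hzy.trans (nsmul_le_nsmul_right h₁ n)) h₂

theorem nsmul_le_nsmul_of_le (hS : IsCuSemigroup S) (x : S) {m n : ℕ} (h : m ≤ n) :
    m • x ≤ n • x := by
  have := hS.isOrderedAddMonoid
  exact nsmul_le_nsmul_left (hS.zero_le x) h

/-- Approximate differences: an almost complement `t` of `a` in `s`. -/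
theorem exists_diff (hS : IsCuSemigroup S) (hwc : WeaklyCancellative S) (h5 : AxiomO5 S)
    {a' a s : S} (ha : WayBelow a' a) (has : a ≤ s) :
    ∃ t, a' + t ≤ s ∧ s ≤ a + t ∧ ∀ r' r, WayBelow r' r → r + a ≤ s → WayBelow r' t := by
  obtain ⟨a₁, h₁, h₂⟩ := hS.exists_between ha
  obtain ⟨t, ht, hst, -⟩ := h5 a' a₁ 0 0 s (by simpa using h₂.le.trans has) h₁
    (hS.zero_wayBelow 0)
  refine ⟨t, ht, hst.trans (hS.add_le_add h₂.le le_rfl), fun r' r hr hra => hwc r' t a₁ ?_⟩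
  rw [add_comm t]
  exact (hS.O3 hr h₂).trans_le (hra.trans hst)

theorem exists_interval (hS : IsCuSemigroup S) (hia : IntervalAxiom S) {x' x y u v : S}
    (hx : WayBelow x' x) (hu : x ≤ y + u) (hv : x ≤ y + v) :
    ∃ w, x' ≤ y + w ∧ WayBelow w u ∧ WayBelow w v := by
  obtain ⟨x₁, h₁, h₂⟩ := hS.exists_between hx
  obtain ⟨w, hw, h⟩ := hia x' x₁ y u v h₁ (h₂.trans_le hu) (h₂.trans_le hv)
  exact ⟨w, hw.le, h⟩

theorem exists_nsmul_le_of_nsmul_le_add (hS : IsCuSemigroup S) (hwc : WeaklyCancellative S)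
    (h5 : AxiomO5 S) (hia : IntervalAxiom S) {y u : S} (n : ℕ) {b' b s : S}
    (hb : WayBelow b' b) (hu : b ≤ y + u) (hs : n • b ≤ y + s) :
    ∃ w, w ≤ u ∧ b' ≤ y + w ∧ n • w ≤ s := by
  have := hS.isOrderedAddMonoid
  induction n generalizing b' b s with
  | zero => exact ⟨u, le_rfl, hb.le.trans hu, by simpa using hS.zero_le s⟩
  | succ n ih =>
    obtain ⟨b₁, hb₁, h⟩ := hS.exists_between hb
    obtain ⟨b₂, hb₂, hb₃⟩ := hS.exists_between h
    have hbs : b ≤ y + s := le_trans (by simpa using hS.nsmul_le_nsmul_of_le b n.succ_pos) hs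
    obtain ⟨f, hf, hfb, hfs⟩ := hS.exists_interval hia hb₃
      (le_add_of_nonneg_left (hS.zero_le y)) hbs
    obtain ⟨y', f', hy', hf', hbf⟩ := hS.exists_le_add (hb₂.trans_le hf)
    obtain ⟨c, hc, hsc, -⟩ := hS.exists_diff hwc h5 hf' hfs.le
    have hnb : WayBelow (n • b₂) (y + c) := by
      refine hwc _ _ f ((hS.O3 (hS.nsmul_wayBelow hb₃ n) hfb).trans_le ?_)
      rw [← succ_nsmul, add_assoc, add_comm c]
      exact hs.trans (hS.add_le_add le_rfl hsc)
    obtain ⟨w, hwu, hbw, hw⟩ := ih hb₂ (hb₃.le.trans hu) hnb.le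
    obtain ⟨v, hv, hvf, hvw⟩ := hS.exists_interval hia hb₁
      (hbf.trans (hS.add_le_add hy'.le le_rfl)) hbw
    refine ⟨v, hvw.le.trans hwu, hv, ?_⟩
    rw [succ_nsmul, add_comm]
    exact (hS.add_le_add hvf.le ((nsmul_le_nsmul_right hvw.le n).trans hw)).trans hc

theorem exists_le_add_nsmul (hS : IsCuSemigroup S) (hia : IntervalAxiom S)
    (hrip : RieszInterpolation S) {b : S} (j : ℕ) {a' a w : S} (ha : WayBelow a' a)
    (h : a ≤ w + j • b) : ∃ e, e ≤ a ∧ e ≤ b ∧ a' ≤ w + j • e := by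
  have := hS.isOrderedAddMonoid
  induction j generalizing a' a w with
  | zero => exact ⟨0, hS.zero_le a, hS.zero_le b, by simpa using ha.le.trans h⟩
  | succ j ih =>
    obtain ⟨a₁, h₁, h₂⟩ := hS.exists_between ha
    obtain ⟨e₁, he₁a, he₁b, he₁⟩ := ih (w := w + b) h₂
      (h.trans_eq (by rw [succ_nsmul]; abel))
    obtain ⟨e₂, he₂, he₂b, he₂a⟩ := hS.exists_interval hia (y := w + j • e₁) (u := b) h₁
      (he₁.trans_eq (by abel))
      (h₂.le.trans (le_add_of_nonneg_left (hS.zero_le _)))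
    obtain ⟨e, h1, h2, hea, heb⟩ := hrip e₁ e₂ a b he₁a he₁b he₂a.le he₂b.le
    refine ⟨e, hea, heb, he₂.trans ?_⟩
    rw [succ_nsmul, ← add_assoc]
    exact hS.add_le_add (hS.add_le_add le_rfl (nsmul_le_nsmul_right h1 j)) h2

end IsCuSemigroup

theorem RieszInterpolation.exists_le_of_lt (hrip : RieszInterpolation S) {p q u : S} (hpu : p ≤ u)
    (hqu : q ≤ u) (t : ℕ → S) (N : ℕ) (h : ∀ i < N, p ≤ t i ∧ q ≤ t i) :
    ∃ c, p ≤ c ∧ q ≤ c ∧ c ≤ u ∧ ∀ i < N, c ≤ t i := by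
  induction N with
  | zero => exact ⟨u, hpu, hqu, le_rfl, by simp⟩
  | succ N ih =>
    obtain ⟨c, hpc, hqc, hcu, hc⟩ := ih fun i hi => h i (by omega)
    obtain ⟨d, hpd, hqd, hdc, hdt⟩ := hrip p q c (t N) hpc (h N (by omega)).1 hqc
      (h N (by omega)).2
    refine ⟨d, hpd, hqd, hdc.trans hcu, fun i hi => ?_⟩
    rcases Nat.lt_succ_iff_lt_or_eq.mp hi with hi | rfl
    · exact hdc.trans (hc i hi)
    · exact hdt

namespace IsCuSemigroup

/-- If all `n`-fold sums formed from `p` and `q` lie below `s`, then `p` and `q` have, up to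
passing to elements way below, a common upper bound `c` with `n • c ≤ s`. -/
theorem exists_upper_nsmul_le (hS : IsCuSemigroup S) (hwc : WeaklyCancellative S)
    (h5 : AxiomO5 S) (hrip : RieszInterpolation S) (n : ℕ) {p' p q' q s u : S}
    (hp : WayBelow p' p) (hq : WayBelow q' q) (hpu : p ≤ u) (hqu : q ≤ u)
    (hs : ∀ i j, i + j = n → i • p + j • q ≤ s) :
    ∃ c, p' ≤ c ∧ q' ≤ c ∧ c ≤ u ∧ n • c ≤ s := by
  have := hS.isOrderedAddMonoid
  induction n generalizing p' p q' q s u with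
  | zero => exact ⟨u, hp.le.trans hpu, hq.le.trans hqu, le_rfl, by simpa using hS.zero_le s⟩
  | succ n ih =>
    obtain ⟨p₀, hp₀, h⟩ := hS.exists_between hp
    obtain ⟨p₁, hp₁, h⟩ := hS.exists_between h
    obtain ⟨p₂, hp₂, hp₃⟩ := hS.exists_between h
    obtain ⟨q₀, hq₀, h⟩ := hS.exists_between hq
    obtain ⟨q₁, hq₁, h⟩ := hS.exists_between h
    obtain ⟨q₂, hq₂, hq₃⟩ := hS.exists_between h
    have hdiff : ∀ i, ∃ t, i < n + 1 →
        (i • p₁ + (n - i) • q₁ + t ≤ s ∧ p₂ ≤ t ∧ q₂ ≤ t) := by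
      intro i
      by_cases hi : i < n + 1
      · have hps : p + (i • p + (n - i) • q) ≤ s :=
          (hs (i + 1) (n - i) (by omega)).trans_eq' (by rw [succ_nsmul]; abel)
        have hqs : q + (i • p + (n - i) • q) ≤ s :=
          (hs i (n - i + 1) (by omega)).trans_eq' (by rw [succ_nsmul]; abel)
        obtain ⟨t, ht, -, hcan⟩ := hS.exists_diff hwc h5
          (hS.O3 (hS.nsmul_wayBelow (hp₂.trans_le hp₃.le) i)
            (hS.nsmul_wayBelow (hq₂.trans_le hq₃.le) (n - i)))
          ((le_add_of_nonneg_left (hS.zero_le p)).trans hps)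
        exact ⟨t, fun _ => ⟨ht, (hcan _ _ hp₃ hps).le, (hcan _ _ hq₃ hqs).le⟩⟩
      · exact ⟨0, fun h => absurd h hi⟩
    choose t ht using hdiff
    obtain ⟨c, hpc, hqc, hcu, hct⟩ := hrip.exists_le_of_lt (hp₃.le.trans hpu)
      (hq₃.le.trans hqu) t (n + 1) fun i hi => (ht i hi).2
    have hcs : ∀ i j, i + j = n → i • p₁ + j • q₁ + c ≤ s := by
      intro i j hij
      obtain rfl : j = n - i := by omega
      exact (hS.add_le_add le_rfl (hct i (by omega))).trans (ht i (by omega)).1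
    obtain ⟨c', hpc', hqc', hc'⟩ := hS.exists_upper (hp₂.trans_le hpc) (hq₂.trans_le hqc)
    obtain ⟨r, hr, -, hcan⟩ := hS.exists_diff hwc h5 hc' (s := s)
      ((le_add_of_nonneg_left (add_nonneg (nsmul_nonneg (hS.zero_le p₁) n)
        (nsmul_nonneg (hS.zero_le q₁) 0))).trans (hcs n 0 rfl))
    obtain ⟨d, hpd, hqd, hdc, hd⟩ := ih (s := r) hp₀ hq₀ (hp₁.le.trans hpc')
      (hq₁.le.trans hqc') fun i j hij =>
        (hcan _ _ (hS.O3 (hS.nsmul_wayBelow hp₁ i) (hS.nsmul_wayBelow hq₁ j)) (hcs i j hij)).le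
    refine ⟨d, hpd, hqd, hdc.trans (hc'.le.trans hcu), ?_⟩
    rw [succ_nsmul, add_comm]
    exact (hS.add_le_add hdc hd).trans hr

/-- Given `k • a ≤ x` and `k • b ≤ x`, one can shrink `a`, up to multiples and passing to elements
way below, so that the mixed sums of `a` and `b` also lie below `x`. -/
theorem exists_mixed_sums_le (hS : IsCuSemigroup S) (hwc : WeaklyCancellative S)
    (h5 : AxiomO5 S) (hia : IntervalAxiom S) (hrip : RieszInterpolation S) {k : ℕ}
    {a b x : S} (hax : k • a ≤ x) (hbx : k • b ≤ x) (i : ℕ) (hik : i ≤ k) {a' b' : S}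
    (ha : WayBelow a' a) (hb : WayBelow b' b) :
    ∃ (m : ℕ) (c : S), k • c ≤ x ∧ a' ≤ m • c ∧
      ∀ l j, l ≤ i → l + j = k → l • c + j • b' ≤ x := by
  have := hS.isOrderedAddMonoid
  induction i generalizing a' b' with
  | zero =>
    refine ⟨1, a, hax, by simpa using ha.le, fun l j hl hlj => ?_⟩
    obtain rfl : l = 0 := by omega
    obtain rfl : j = k := by omega
    simpa using (nsmul_le_nsmul_right hb.le j).trans hbx
  | succ i ih =>
    obtain ⟨a₁, ha₁, ha₂⟩ := hS.exists_between ha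
    obtain ⟨b₂, hb₁, hb₂⟩ := hS.exists_between hb
    obtain ⟨m, d, hdx, had, hmix⟩ := ih (by omega) ha₂ hb₂
    obtain ⟨d', hd', had'⟩ := hS.exists_le_nsmul m (ha₁.trans_le had)
    obtain ⟨d₀, hd₀, h⟩ := hS.exists_between hd'
    obtain ⟨d₁, hd₁, hd₂⟩ := hS.exists_between h
    obtain ⟨j, rfl⟩ := Nat.exists_eq_add_of_le hik
    obtain ⟨s, hs, hxs, hcan⟩ := hS.exists_diff hwc h5 (hS.nsmul_wayBelow hb₁ j)
      (((hS.nsmul_le_nsmul_of_le b₂ (Nat.le_add_left j (i + 1))).trans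
        (nsmul_le_nsmul_right hb₂.le _)).trans hbx)
    obtain ⟨w, hwd, hdw, hws⟩ := hS.exists_nsmul_le_of_nsmul_le_add hwc h5 hia (y := j • b₂)
      (u := d) (i + 1) (s := s) hd₂ (le_add_of_nonneg_left (nsmul_nonneg (hS.zero_le b₂) j))
      (((hS.nsmul_le_nsmul_of_le d (Nat.le_add_right (i + 1) j)).trans hdx).trans hxs)
    obtain ⟨e, hed, heb, hde⟩ := hS.exists_le_add_nsmul hia hrip j hd₁
      (hdw.trans_eq (add_comm _ _))
    obtain ⟨w', g, hw', hg, hd'w⟩ := hS.exists_le_add (hd₀.trans_le hde)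
    obtain ⟨e', he', hge⟩ := hS.exists_le_nsmul j hg
    obtain ⟨w'', hw₁, hw₂⟩ := hS.exists_between hw'
    obtain ⟨e'', he₁, he₂⟩ := hS.exists_between he'
    obtain ⟨c, hwc', hec, hcd, hc⟩ := hS.exists_upper_nsmul_le hwc h5 hrip (i + 1) (s := s)
      (u := d) hw₁ he₁ (hw₂.le.trans hwd) (he₂.le.trans (hed.trans hd₂.le)) (by
        intro p q hpq
        rcases Nat.eq_zero_or_pos q with rfl | hq
        · obtain rfl : p = i + 1 := by omega
          simpa using (nsmul_le_nsmul_right hw₂.le (i + 1)).trans hws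
        · refine (hcan _ _ (hS.O3 (hS.nsmul_wayBelow hw₂ p) (hS.nsmul_wayBelow he₂ q)) ?_).le
          refine le_trans ?_ (hmix p (q + j) (by omega) (by omega))
          rw [add_nsmul, ← add_assoc]
          exact hS.add_le_add (hS.add_le_add (nsmul_le_nsmul_right hwd p)
            (nsmul_le_nsmul_right heb q)) le_rfl)
    refine ⟨(1 + j) * m, c, (nsmul_le_nsmul_right hcd _).trans hdx, ?_, fun l j' hl hlj => ?_⟩
    · refine had'.trans ?_
      rw [mul_nsmul, add_nsmul, one_nsmul]
      exact nsmul_le_nsmul_right (hd'w.trans (hS.add_le_add hwc'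
        (hge.trans (nsmul_le_nsmul_right hec j)))) m
    · rcases Nat.le_succ_iff.mp hl with hl | rfl
      · exact (hS.add_le_add (nsmul_le_nsmul_right hcd l) (nsmul_le_nsmul_right hb₁.le j')).trans
          (hmix l j' hl hlj)
      · obtain rfl : j' = j := by omega
        rw [add_comm]
        exact (hS.add_le_add le_rfl hc).trans hs

theorem exists_nsmul_upper (hS : IsCuSemigroup S) (hwc : WeaklyCancellative S)
    (h5 : AxiomO5 S) (hia : IntervalAxiom S) (hrip : RieszInterpolation S) {k : ℕ}
    {a' a b' b x : S} (hax : k • a ≤ x) (hbx : k • b ≤ x) (ha : WayBelow a' a)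
    (hb : WayBelow b' b) :
    ∃ (m : ℕ) (c : S), k • c ≤ x ∧ a' ≤ m • c ∧ b' ≤ m • c := by
  have := hS.isOrderedAddMonoid
  obtain ⟨a₁, ha₁, ha₂⟩ := hS.exists_between ha
  obtain ⟨b₁, hb₁, hb₂⟩ := hS.exists_between hb
  obtain ⟨m, d, -, had, hmix⟩ := hS.exists_mixed_sums_le hwc h5 hia hrip hax hbx k le_rfl ha₂ hb₂
  obtain ⟨d', hd', had'⟩ := hS.exists_le_nsmul m (ha₁.trans_le had)
  obtain ⟨c, hdc, hbc, -, hc⟩ := hS.exists_upper_nsmul_le hwc h5 hrip k (u := d + b₁) hd' hb₁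
    (le_add_of_nonneg_right (hS.zero_le _)) (le_add_of_nonneg_left (hS.zero_le _))
    fun i j hij => hmix i j (by omega) hij
  refine ⟨m + 1, c, hc, ?_, ?_⟩
  · exact (had'.trans (nsmul_le_nsmul_right hdc m)).trans (hS.nsmul_le_nsmul_of_le c m.le_succ)
  · exact hbc.trans (by simpa using hS.nsmul_le_nsmul_of_le c (Nat.le_add_left 1 m))

theorem exists_le_nsmul_of_wayBelow_sum (hS : IsCuSemigroup S) (hwc : WeaklyCancellative S)
    (h5 : AxiomO5 S) (hia : IntervalAxiom S) (hrip : RieszInterpolation S) {k : ℕ} {x : S}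
    (n : ℕ) (y : Fin n → S) (hy : ∀ j, k • y j ≤ x) {x' : S} (hx : WayBelow x' (∑ j, y j)) :
    ∃ (m : ℕ) (c : S), k • c ≤ x ∧ x' ≤ m • c := by
  have := hS.isOrderedAddMonoid
  induction n generalizing x' with
  | zero => exact ⟨0, 0, by simpa using hS.zero_le x, by simpa using hx.le⟩
  | succ n ih =>
    rw [Fin.sum_univ_castSucc] at hx
    obtain ⟨z, y', hz, hy', hxz⟩ := hS.exists_le_add hx
    obtain ⟨z₁, hz₁, hz₂⟩ := hS.exists_between hz
    obtain ⟨m, c, hc, hzc⟩ := ih (fun j => y j.castSucc) (fun j => hy _) hz₂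
    obtain ⟨c', hc', hzc'⟩ := hS.exists_le_nsmul m (hz₁.trans_le hzc)
    obtain ⟨l, d, hd, hcd, hyd⟩ := hS.exists_nsmul_upper hwc h5 hia hrip hc (hy _) hc' hy'
    refine ⟨l * m + l, d, hd, hxz.trans ?_⟩
    rw [add_nsmul, mul_nsmul]
    exact hS.add_le_add (hzc'.trans (nsmul_le_nsmul_right hcd m)) hyd

end IsCuSemigroup

theorem weaklyDivisible_iff_divisible (S : Type*) [AddCommMonoid S] [PartialOrder S]
    (hS : IsCuSemigroup S) (hwc : WeaklyCancellative S) (h5 : AxiomO5 S)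
    (hia : IntervalAxiom S) (hrip : RieszInterpolation S)
    (x : S) (k : ℕ) (hk : 2 ≤ k) :
    IsWeaklyDivisible k x ↔ IsDivisible k x := by
  refine ⟨fun h x' hx' => ?_, fun h x' hx' => ?_⟩
  · obtain ⟨x₁, h₁, h₂⟩ := hS.exists_between hx'
    obtain ⟨n, y, hy, hxy⟩ := h x₁ h₂
    exact hS.exists_le_nsmul_of_wayBelow_sum hwc h5 hia hrip n y hy (h₁.trans_le hxy)
  · obtain ⟨n, y, hy, hxy⟩ := h x' hx'
    exact ⟨n, fun _ => y, fun _ => hy, by simpa using hxy⟩
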